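/- Suppose that for some dimension d ≥ 1 and constant c'_d, for every integer N ≥ 2 and every set P of N points in [0,1]^d there is a coloring y : P → {−1, +1} with |∑_{p ∈ P ∩ A} y(p)| ≤ c'_d (log N)^{d + 1/2} for every axis-parallel box A ⊆ [0,1]^d with one vertex at the origin (Larsen's bound for Tusnády's problem). Then there exists a constant c_d such that for every integer N ≥ 2 and every Borel probability measure μ on [0,1]^d there exist points x_1, ..., x_N ∈ [0,1]^d with D_N*(x_1, ..., x_N; μ) ≤ c_d (log N)^{d + 1/2} / N. -/

import Mathlib

open MeasureTheory

section Transference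

variable {ι X : Type*}

/-- A coloring bound for finite sets of points, monotone in the number of points, extends to
finite families of points with repetitions: equal points are paired and colored oppositely. -/
theorem exists_coloring_family {Q : Set X} {𝒜 : Set (Set X)} {B : ℕ → ℝ} (hB : Monotone B)
    (hcol : ∀ P : Finset X, ↑P ⊆ Q → ∃ y : X → ℝ, (∀ p ∈ P, y p = 1 ∨ y p = -1) ∧
      ∀ A ∈ 𝒜, |∑ p ∈ P, A.indicator y p| ≤ B P.card)
    (x : ι → X) (hx : ∀ i, x i ∈ Q) (S : Finset ι) :
    ∃ y : ι → ℝ, (∀ i ∈ S, y i = 1 ∨ y i = -1) ∧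
      ∀ A ∈ 𝒜, |∑ i ∈ S, y i * A.indicator (fun _ => (1 : ℝ)) (x i)| ≤ B S.card := by
  classical
  induction S using Finset.strongInduction with
  | H S ih =>
  by_cases hinj : Set.InjOn x S
  · obtain ⟨y, hy, hyA⟩ := hcol (S.image x) (by
      intro p hp
      obtain ⟨i, -, rfl⟩ := Finset.mem_image.1 (Finset.mem_coe.1 hp)
      exact hx i)
    refine ⟨fun i => y (x i), fun i hi => hy _ (Finset.mem_image_of_mem x hi), fun A hA => ?_⟩
    have h := hyA A hA
    rw [Finset.sum_image hinj, Finset.card_image_of_injOn hinj] at h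
    convert h using 3 with i hi
    by_cases hi : x i ∈ A <;> simp [hi]
  · simp only [Set.InjOn, not_forall] at hinj
    obtain ⟨i, hi, j, hj, hij, hne⟩ := hinj
    have hi' : i ∈ S := hi
    have hj' : j ∈ S.erase i := Finset.mem_erase.2 ⟨fun h => hne h.symm, hj⟩
    have hsub : (S.erase i).erase j ⊂ S :=
      (Finset.erase_subset _ _).trans_ssubset (Finset.erase_ssubset hi')
    obtain ⟨y, hy, hyA⟩ := ih _ hsub
    refine ⟨fun k => if k = i then 1 else if k = j then -1 else y k, fun k hk => ?_,
      fun A hA => ?_⟩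
    · by_cases hki : k = i
      · simp [hki]
      · by_cases hkj : k = j
        · exact Or.inr (by simp [hkj, Ne.symm hne])
        · simpa [hki, hkj] using hy k (by simp [hki, hkj, hk])
    · rw [← Finset.add_sum_erase S _ hi', ← Finset.add_sum_erase (S.erase i) _ hj']
      have hrest : ∑ k ∈ (S.erase i).erase j,
          (if k = i then 1 else if k = j then -1 else y k) *
            A.indicator (fun _ => (1 : ℝ)) (x k) =
          ∑ k ∈ (S.erase i).erase j, y k * A.indicator (fun _ => (1 : ℝ)) (x k) := by
        refine Finset.sum_congr rfl fun k hk => ?_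
        simp only [Finset.mem_erase] at hk
        simp [hk.1, hk.2.1]
      rw [hrest]
      simp only [if_true, if_neg (Ne.symm hne), hij, one_mul, neg_mul, add_neg_cancel_left]
      exact (hyA A hA).trans (hB (Finset.card_le_card hsub.subset))

theorem abs_sum_indicator_sub_le {A : Set X} (x : ι → X) {S T : Finset ι} (h : S ⊆ T) :
    |∑ i ∈ T, A.indicator (fun _ => (1 : ℝ)) (x i) -
      ∑ i ∈ S, A.indicator (fun _ => (1 : ℝ)) (x i)| ≤ (T.card : ℝ) - S.card := by
  classical
  rw [← Finset.sum_sdiff_eq_sub h, ← Nat.cast_sub (Finset.card_le_card h),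
    ← Finset.card_sdiff_of_subset h]
  refine (Finset.abs_sum_le_sum_abs _ _).trans ?_
  refine (Finset.sum_le_card_nsmul _ _ 1 fun i _ => ?_).trans (by simp)
  by_cases hi : x i ∈ A <;> simp [hi]

/-- A family of `2 m` points contains `m` of them, roughly half in every set of the class. -/
theorem exists_halving {Q : Set X} {𝒜 : Set (Set X)} {B : ℕ → ℝ} (hQ : Q ∈ 𝒜) (x : ι → X)
    (hx : ∀ i, x i ∈ Q) (S : Finset ι) {m : ℕ} (hS : S.card = 2 * m)
    (hcol : ∃ y : ι → ℝ, (∀ i ∈ S, y i = 1 ∨ y i = -1) ∧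
      ∀ A ∈ 𝒜, |∑ i ∈ S, y i * A.indicator (fun _ => (1 : ℝ)) (x i)| ≤ B S.card) :
    ∃ T ⊆ S, T.card = m ∧ ∀ A ∈ 𝒜,
      |2 * ∑ i ∈ T, A.indicator (fun _ => (1 : ℝ)) (x i) -
        ∑ i ∈ S, A.indicator (fun _ => (1 : ℝ)) (x i)| ≤ 2 * B (2 * m) := by
  classical
  obtain ⟨y, hy, hyA⟩ := hcol
  set U := S.filter (fun i => y i = 1) with hU
  have hUS : U ⊆ S := Finset.filter_subset _ _
  have hsum : ∀ f : ι → ℝ, ∑ i ∈ S, y i * f i = 2 * ∑ i ∈ U, f i - ∑ i ∈ S, f i := by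
    intro f
    rw [hU, Finset.sum_filter, Finset.mul_sum, ← Finset.sum_sub_distrib]
    refine Finset.sum_congr rfl fun i hi => ?_
    rcases hy i hi with h | h
    · simp [h]; ring
    · norm_num [h]
  have hcard : |2 * (U.card : ℝ) - 2 * m| ≤ B (2 * m) := by
    have h := hyA Q hQ
    rw [hsum, hS] at h
    simpa [hx, hS] using h
  obtain ⟨T, hTS, hTm, hTU⟩ : ∃ T ⊆ S, T.card = m ∧ ∀ A : Set X,
      |∑ i ∈ T, A.indicator (fun _ => (1 : ℝ)) (x i) -
        ∑ i ∈ U, A.indicator (fun _ => (1 : ℝ)) (x i)| ≤ |(U.card : ℝ) - m| := by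
    rcases le_total m U.card with h | h
    · obtain ⟨T, hT, hTm⟩ := Finset.exists_subset_card_eq h
      refine ⟨T, hT.trans hUS, hTm, fun A => ?_⟩
      rw [abs_sub_comm, ← hTm]
      exact (abs_sum_indicator_sub_le x hT).trans (le_abs_self _)
    · obtain ⟨T, hUT, hTS, hTm⟩ := Finset.exists_subsuperset_card_eq hUS h (by omega)
      refine ⟨T, hTS, hTm, fun A => ?_⟩
      rw [abs_sub_comm (U.card : ℝ), ← hTm]
      exact (abs_sum_indicator_sub_le x hUT).trans (le_abs_self _)
  refine ⟨T, hTS, hTm, fun A hA => ?_⟩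
  have h1 := hyA A hA
  rw [hsum, hS] at h1
  have h2 := hTU A
  have h3 : |2 * (U.card : ℝ) - 2 * m| = 2 * |(U.card : ℝ) - m| := by
    rw [← mul_sub, abs_mul]; simp
  rw [h3] at hcard
  have h4 := h2.trans (show _ ≤ B (2 * m) / 2 by linarith)
  rw [abs_le] at h1 h4 ⊢
  constructor <;> linarith [h1.1, h1.2, h4.1, h4.2]

theorem exists_iterated_halving {Q : Set X} {𝒜 : Set (Set X)} {B : ℕ → ℝ} (hQ : Q ∈ 𝒜)
    (x : ι → X) (hx : ∀ i, x i ∈ Q)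
    (hcol : ∀ S : Finset ι, ∃ y : ι → ℝ, (∀ i ∈ S, y i = 1 ∨ y i = -1) ∧
      ∀ A ∈ 𝒜, |∑ i ∈ S, y i * A.indicator (fun _ => (1 : ℝ)) (x i)| ≤ B S.card)
    {N : ℕ} (hN : 0 < N) (k : ℕ) (S : Finset ι) (hS : S.card = 2 ^ k * N) :
    ∃ T ⊆ S, T.card = N ∧ ∀ A ∈ 𝒜,
      |(∑ i ∈ T, A.indicator (fun _ => (1 : ℝ)) (x i)) / N -
        (∑ i ∈ S, A.indicator (fun _ => (1 : ℝ)) (x i)) / (2 ^ k * N)| ≤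
          ∑ j ∈ Finset.range k, B (2 ^ (j + 1) * N) / (2 ^ j * N) := by
  induction k generalizing S with
  | zero => exact ⟨S, subset_rfl, by simpa using hS, fun A _ => by simp⟩
  | succ k ih =>
    have hS' : S.card = 2 * (2 ^ k * N) := by rw [hS]; ring
    obtain ⟨R, hRS, hR, hRA⟩ := exists_halving hQ x hx S hS' (hcol S)
    obtain ⟨T, hTR, hT, hTA⟩ := ih R hR
    refine ⟨T, hTR.trans hRS, hT, fun A hA => ?_⟩
    rw [Finset.sum_range_succ]
    refine (abs_sub_le _ _ _).trans (add_le_add (hTA A hA) ?_)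
    have hN' : (0 : ℝ) < 2 ^ k * N := by positivity
    have h : 2 ^ (k + 1) * N = 2 * (2 ^ k * N) := by ring
    rw [h]
    have key : ∀ r s : ℝ, r / (2 ^ k * N) - s / (2 ^ (k + 1) * N) =
        (2 * r - s) / (2 * (2 ^ k * N)) := by
      intro r s
      field_simp
      ring
    rw [key, abs_div, abs_of_pos (by positivity : (0 : ℝ) < 2 * (2 ^ k * N)),
      div_le_div_iff₀ (by positivity) hN']
    nlinarith [hRA A hA]

end Transference

section Empirical

/-- Every nonnegative weight vector of total mass one is rounded to integer multiplicities. -/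
theorem exists_nat_rounding {C : Type*} [Fintype C] (w : C → ℝ) (hw : ∀ c, 0 ≤ w c)
    (hw1 : ∑ c, w c = 1) (M : ℕ) :
    ∃ n : C → ℕ, ∑ c, n c = M ∧ (∀ c, 0 < n c → 0 < w c) ∧
      ∀ c, |(n c : ℝ) - M * w c| ≤ Fintype.card C := by
  classical
  obtain ⟨c₀, hc₀⟩ : ∃ c, 0 < w c := by
    by_contra! h
    have := Finset.sum_nonpos fun c (_ : c ∈ Finset.univ) => h c
    linarith
  have hfl : ∀ c, (⌊M * w c⌋₊ : ℝ) ≤ M * w c := fun c =>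
    Nat.floor_le (mul_nonneg (Nat.cast_nonneg _) (hw c))
  have hlt : ∀ c, M * w c - 1 ≤ ⌊M * w c⌋₊ := fun c => (Nat.sub_one_lt_floor _).le
  have hMw : ∑ c, M * w c = M := by rw [← Finset.mul_sum, hw1, mul_one]
  set s := ∑ c, ⌊M * w c⌋₊ with hs
  have hsM : s ≤ M := by
    have : (s : ℝ) ≤ M := by
      rw [hs, Nat.cast_sum]
      exact (Finset.sum_le_sum fun c _ => hfl c).trans_eq hMw
    exact_mod_cast this
  have hsr : (M : ℝ) - s ≤ Fintype.card C := by
    have := Finset.sum_le_sum fun c (_ : c ∈ Finset.univ) => hlt c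
    rw [Finset.sum_sub_distrib, hMw, ← Nat.cast_sum, ← hs] at this
    simp only [Finset.sum_const, Finset.card_univ, nsmul_eq_mul, mul_one] at this
    linarith
  have hC : (1 : ℝ) ≤ Fintype.card C := by
    exact_mod_cast Fintype.card_pos_iff.2 ⟨c₀⟩
  refine ⟨fun c => ⌊M * w c⌋₊ + if c = c₀ then M - s else 0, ?_, fun c hc => ?_, fun c => ?_⟩
  · rw [Finset.sum_add_distrib, ← hs]
    simp
    omega
  · by_cases h : c = c₀
    · rwa [h]
    · refine (hw c).lt_of_ne fun h0 => ?_
      simp [h, ← h0] at hc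
  · have h1 := hfl c
    have h2 := hlt c
    have h3 : (s : ℝ) ≤ M := by exact_mod_cast hsM
    rw [abs_le]
    by_cases h : c = c₀
    · subst h
      simp only [if_true, Nat.cast_add, Nat.cast_sub hsM]
      constructor <;> linarith
    · simp only [h, if_false, add_zero]
      constructor <;> linarith

/-- For a finite measurable partition, large finite families of points of a full-measure set
reproduce the masses of all unions of cells up to `ε`. -/
theorem exists_points_approx_partition {X C : Type*} [MeasurableSpace X] (μ : Measure X)
    [IsProbabilityMeasure μ] [Fintype C] [MeasurableSpace C] [MeasurableSingletonClass C]
    (τ : X → C) (hτ : Measurable τ) {Q : Set X} (hQ : ∀ᵐ x ∂μ, x ∈ Q) {ε : ℝ} (hε : 0 < ε) :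
    ∃ M₀ : ℕ, ∀ M ≥ M₀, ∃ z : Fin M → X, (∀ n, z n ∈ Q) ∧ ∀ O : Set C,
      |(∑ n, (τ ⁻¹' O).indicator (fun _ => (1 : ℝ)) (z n)) / M - μ.real (τ ⁻¹' O)| ≤ ε := by
  classical
  set D : ℝ := (Fintype.card C : ℝ) with hD
  obtain ⟨M₀, hM₀⟩ := exists_nat_gt (D * D / ε)
  refine ⟨M₀, fun M hM => ?_⟩
  have hM' : D * D / ε < M := hM₀.trans_le (by exact_mod_cast hM)
  have hMpos : (0 : ℝ) < M := lt_of_le_of_lt (by positivity) hM'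
  have hsum : ∀ O : Set C, μ.real (τ ⁻¹' O) = ∑ c, if c ∈ O then μ.real (τ ⁻¹' {c}) else 0 := by
    intro O
    rw [← Finset.sum_filter, ← measureReal_biUnion_finset
      (fun c _ c' _ h => (Set.disjoint_singleton.2 h).preimage τ)
      fun c _ => hτ (measurableSet_singleton c)]
    congr 1
    ext x
    simp
  obtain ⟨n, hn, hnpos, hnw⟩ := exists_nat_rounding (fun c => μ.real (τ ⁻¹' {c}))
    (fun c => measureReal_nonneg) (by simpa using (hsum Set.univ).symm) M
  have hrep : ∀ c, 0 < n c → ∃ x ∈ Q, τ x = c := by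
    intro c hc
    by_contra! h
    have h0 : μ (τ ⁻¹' {c}) = 0 := by
      refine measure_mono_null (fun x hx => ?_) hQ
      exact fun hxQ => h x hxQ hx
    have := hnpos c hc
    simp [measureReal_def, h0] at this
  let f : (Σ c, Fin (n c)) → X := fun p => (hrep p.1 p.2.pos).choose
  have hf : ∀ p, f p ∈ Q ∧ τ (f p) = p.1 := fun p => (hrep p.1 p.2.pos).choose_spec
  have hcard : Fintype.card (Σ c, Fin (n c)) = M := by simp [hn]
  let e : Fin M ≃ Σ c, Fin (n c) := (Fintype.equivFinOfCardEq hcard).symm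
  refine ⟨fun m => f (e m), fun m => (hf _).1, fun O => ?_⟩
  have hcount : ∑ m, (τ ⁻¹' O).indicator (fun _ => (1 : ℝ)) (f (e m)) =
      ∑ c, if c ∈ O then (n c : ℝ) else 0 := by
    rw [Equiv.sum_comp e fun p => (τ ⁻¹' O).indicator (fun _ => (1 : ℝ)) (f p),
      Fintype.sum_sigma]
    refine Finset.sum_congr rfl fun c _ => ?_
    by_cases hc : c ∈ O <;> simp [Set.indicator, hf, hc]
  have hdiff : |(∑ c, if c ∈ O then (n c : ℝ) else 0) - M * μ.real (τ ⁻¹' O)| ≤ D * D := by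
    rw [hsum O, Finset.mul_sum, ← Finset.sum_sub_distrib]
    refine (Finset.abs_sum_le_sum_abs _ _).trans ?_
    refine (Finset.sum_le_card_nsmul _ _ D fun c _ => ?_).trans (by simp [hD])
    by_cases hc : c ∈ O
    · simpa [hc] using hnw c
    · simp [hc, hD]
  rw [hcount, div_sub' hMpos.ne', abs_div, abs_of_pos hMpos, div_le_iff₀ hMpos]
  refine hdiff.trans ?_
  rw [div_lt_iff₀ hε] at hM'
  linarith

/-- If every set of the class is a union of cells of a finite partition up to a set of measure
at most `δ`, then the class is uniformly approximated by large finite families of points. -/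
theorem exists_points_approx_of_bracketing {X C : Type*} [MeasurableSpace X] (μ : Measure X)
    [IsProbabilityMeasure μ] [Fintype C] [MeasurableSpace C] [MeasurableSingletonClass C]
    (τ : X → C) (hτ : Measurable τ) {Q : Set X} (hQ : ∀ᵐ x ∂μ, x ∈ Q) {ε δ : ℝ} (hε : 0 < ε)
    {𝒜 : Set (Set X)}
    (hbr : ∀ A ∈ 𝒜, ∃ E : Set X, μ.real E ≤ δ ∧
      ∀ s ∈ A, ∀ t ∉ A, τ s = τ t → s ∈ E ∧ t ∈ E) :
    ∃ M₀ : ℕ, ∀ M ≥ M₀, ∃ z : Fin M → X, (∀ n, z n ∈ Q) ∧ ∀ A ∈ 𝒜,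
      |(∑ n, A.indicator (fun _ => (1 : ℝ)) (z n)) / M - μ.real A| ≤ ε + δ := by
  obtain ⟨M₀, hM₀⟩ := exists_points_approx_partition μ τ hτ hQ hε
  refine ⟨M₀, fun M hM => ?_⟩
  obtain ⟨z, hz, hzO⟩ := hM₀ M hM
  refine ⟨z, hz, fun A hA => ?_⟩
  obtain ⟨E, hE, hEA⟩ := hbr A hA
  have hmono : ∀ A₁ A₂ : Set X, A₁ ⊆ A₂ →
      (∑ n, A₁.indicator (fun _ => (1 : ℝ)) (z n)) / M ≤
        (∑ n, A₂.indicator (fun _ => (1 : ℝ)) (z n)) / M := by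
    intro A₁ A₂ h
    gcongr
  have houter : A ⊆ τ ⁻¹' (τ '' A) := Set.subset_preimage_image τ A
  have hinner : τ ⁻¹' (τ '' Aᶜ)ᶜ ⊆ A := by
    intro x hx
    by_contra h
    exact hx ⟨x, h, rfl⟩
  have houter' : μ.real (τ ⁻¹' (τ '' A)) ≤ μ.real A + δ := by
    refine (measureReal_mono (s₂ := A ∪ E) ?_).trans
      ((measureReal_union_le _ _).trans (by linarith))
    rintro t ⟨s, hs, hst⟩
    by_cases ht : t ∈ A
    · exact Or.inl ht
    · exact Or.inr (hEA s hs t ht hst).2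
  have hinner' : μ.real A ≤ μ.real (τ ⁻¹' (τ '' Aᶜ)ᶜ) + δ := by
    refine (measureReal_mono (s₂ := τ ⁻¹' (τ '' Aᶜ)ᶜ ∪ E) ?_).trans
      ((measureReal_union_le _ _).trans (by linarith))
    intro s hs
    by_cases h : τ s ∈ τ '' Aᶜ
    · obtain ⟨t, ht, hts⟩ := h
      exact Or.inr (hEA s hs t ht hts.symm).1
    · exact Or.inl h
  have h1 := abs_le.1 (hzO (τ '' A))
  have h2 := abs_le.1 (hzO (τ '' Aᶜ)ᶜ)
  have h3 := hmono _ _ houter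
  have h4 := hmono _ _ hinner
  rw [abs_le]
  constructor <;> linarith [h1.1, h1.2, h2.1, h2.2]

/-- Bracketing of half-lines on the real line with respect to a probability measure. -/
theorem exists_bracketing_Iic (ν : Measure ℝ) [IsProbabilityMeasure ν] {K : ℕ} (hK : 0 < K) :
    ∃ τ : ℝ → Fin (K + 1) × Fin (K + 1), Measurable τ ∧ ∀ a : ℝ, ∃ E : Set ℝ,
      MeasurableSet E ∧ ν.real E ≤ 1 / K ∧
        ∀ s t, s ≤ a → a < t → τ s = τ t → s ∈ E ∧ t ∈ E := by
  have hK' : (0 : ℝ) < K := by exact_mod_cast hK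
  have hbd : ∀ A : Set ℝ, ⌊K * ν.real A⌋₊ < K + 1 := fun A => by
    refine Nat.lt_succ_of_le (Nat.floor_le_of_le ?_)
    exact mul_le_of_le_one_right hK'.le measureReal_le_one
  have hmF : Monotone fun t => (⟨_, hbd (Set.Iic t)⟩ : Fin (K + 1)) := fun s t h =>
    Nat.floor_mono (mul_le_mul_of_nonneg_left (measureReal_mono (Set.Iic_subset_Iic.2 h)) hK'.le)
  have hmG : Monotone fun t => (⟨_, hbd (Set.Iio t)⟩ : Fin (K + 1)) := fun s t h =>
    Nat.floor_mono (mul_le_mul_of_nonneg_left (measureReal_mono (Set.Iio_subset_Iio h)) hK'.le)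
  set τ : ℝ → Fin (K + 1) × Fin (K + 1) :=
    fun t => (⟨_, hbd (Set.Iic t)⟩, ⟨_, hbd (Set.Iio t)⟩)
  have hτ : Measurable τ := hmF.measurable.prodMk hmG.measurable
  have hmono : Monotone τ := fun s t h => ⟨hmF h, hmG h⟩
  refine ⟨τ, hτ, fun a => ?_⟩
  have hcell : ∀ s t, s ≤ a → a < t → τ s = τ t →
      τ s = τ a ∧ τ t = τ a ∧ (τ a).1 = (τ a).2 := by
    intro s t hs ht h
    have hsa : τ s = τ a := le_antisymm (hmono hs) (h ▸ hmono ht.le)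
    refine ⟨hsa, h ▸ hsa, le_antisymm ?_ ?_⟩
    · have h1 : (τ a).1 ≤ (τ t).2 := Nat.floor_mono
        (mul_le_mul_of_nonneg_left (measureReal_mono fun u hu => lt_of_le_of_lt hu ht) hK'.le)
      rwa [← h, hsa] at h1
    · exact Nat.floor_mono
        (mul_le_mul_of_nonneg_left (measureReal_mono Set.Iio_subset_Iic_self) hK'.le)
  by_cases hpq : (τ a).1 = (τ a).2
  swap
  · exact ⟨∅, MeasurableSet.empty, by simp, fun s t hs ht h => absurd (hcell s t hs ht h).2.2 hpq⟩
  have hE : MeasurableSet (τ ⁻¹' {τ a}) := hτ (measurableSet_singleton _)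
  refine ⟨τ ⁻¹' {τ a}, hE, ?_, fun s t hs ht h => ⟨(hcell s t hs ht h).1, (hcell s t hs ht h).2.1⟩⟩
  have hIcc : ∀ s t, s ≤ t → τ s = τ a → τ t = τ a → ν.real (Set.Icc s t) ≤ 1 / K := by
    intro s t hst hs ht
    have hsub : Set.Iio s ⊆ Set.Iic t := fun u hu => (le_of_lt hu).trans hst
    have h1 : ν.real (Set.Icc s t) = ν.real (Set.Iic t) - ν.real (Set.Iio s) := by
      rw [← measureReal_sdiff hsub measurableSet_Iio]
      congr 1
      ext u
      simp
    have h2 : ⌊K * ν.real (Set.Iic t)⌋₊ = ⌊K * ν.real (Set.Iio s)⌋₊ := by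
      have : (τ t).1 = (τ s).2 := by rw [hs, ht, hpq]
      exact congrArg Fin.val this
    have h3 := Nat.lt_floor_add_one (K * ν.real (Set.Iic t))
    have h4 := Nat.floor_le (mul_nonneg hK'.le (measureReal_nonneg (μ := ν) (s := Set.Iio s)))
    rw [h1, le_div_iff₀ hK']
    rw [h2] at h3
    linarith
  by_contra! hlt
  have hlt' : ENNReal.ofReal (1 / K) < ν (τ ⁻¹' {τ a}) :=
    (ENNReal.ofReal_lt_iff_lt_toReal (by positivity) (measure_ne_top _ _)).2 hlt
  obtain ⟨F, hFE, hF, hFlt⟩ := hE.exists_lt_isCompact hlt'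
  rcases F.eq_empty_or_nonempty with rfl | hne
  · simp at hFlt
  have hs := hF.sInf_mem hne
  have ht := hF.sSup_mem hne
  have hFI : F ⊆ Set.Icc (sInf F) (sSup F) := fun u hu =>
    ⟨csInf_le hF.bddBelow hu, le_csSup hF.bddAbove hu⟩
  have h1 := hIcc _ _ ((hFI hs).2) (hFE hs) (hFE ht)
  have h2 := (ENNReal.ofReal_lt_iff_lt_toReal (by positivity) (measure_ne_top _ _)).1 hFlt
  have h3 : ν.real F ≤ ν.real (Set.Icc (sInf F) (sSup F)) := measureReal_mono hFI
  rw [measureReal_def] at h3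
  linarith

/-- Every probability measure on the unit cube is approximated uniformly on anchored boxes by the
uniform distribution on any sufficiently large number of suitable points. -/
theorem exists_points_approx_boxes {d : ℕ} (μ : Measure (Fin d → ℝ)) [IsProbabilityMeasure μ]
    (hμ : μ (Set.Icc 0 1) = 1) {ε : ℝ} (hε : 0 < ε) :
    ∃ M₀ : ℕ, ∀ M ≥ M₀, ∃ z : Fin M → (Fin d → ℝ), (∀ n, z n ∈ Set.Icc 0 1) ∧
      ∀ a : Fin d → ℝ,
        |(∑ n, (Set.Icc 0 a).indicator (fun _ => (1 : ℝ)) (z n)) / M - μ.real (Set.Icc 0 a)|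
          ≤ ε := by
  have hQ : ∀ᵐ x ∂μ, x ∈ Set.Icc (0 : Fin d → ℝ) 1 := by
    rw [← prob_compl_eq_zero_iff measurableSet_Icc] at hμ
    exact hμ
  obtain ⟨K, hK⟩ := exists_nat_gt (d / (ε / 2))
  have hK0 : (0 : ℝ) < K := lt_of_le_of_lt (by positivity) hK
  have : ∀ i, IsProbabilityMeasure (μ.map fun x => x i) := fun i =>
    Measure.isProbabilityMeasure_map (measurable_pi_apply i).aemeasurable
  choose τ hτ hbr using fun i : Fin d =>
    exists_bracketing_Iic (μ.map fun x => x i) (K := K) (by exact_mod_cast hK0)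
  have key := exists_points_approx_of_bracketing μ (fun x i => τ i (x i))
    (measurable_pi_lambda _ fun i => (hτ i).comp (measurable_pi_apply i)) hQ
    (ε := ε / 2) (δ := ε / 2) (half_pos hε) (𝒜 := Set.range Set.Iic) ?_
  · obtain ⟨M₀, hM₀⟩ := key
    refine ⟨M₀, fun M hM => ?_⟩
    obtain ⟨z, hz, hzA⟩ := hM₀ M hM
    refine ⟨z, hz, fun a => ?_⟩
    have h := hzA _ ⟨a, rfl⟩
    have h1 : μ.real (Set.Icc 0 a) = μ.real (Set.Iic a) := by
      refine measureReal_congr ?_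
      filter_upwards [hQ] with x hx
      exact propext ⟨fun h => h.2, fun h => ⟨hx.1, h⟩⟩
    have h2 : ∀ n, (Set.Icc 0 a).indicator (fun _ => (1 : ℝ)) (z n) =
        (Set.Iic a).indicator (fun _ => (1 : ℝ)) (z n) := by
      intro n
      have h0 : z n ∈ Set.Icc 0 a ↔ z n ∈ Set.Iic a := ⟨fun h => h.2, fun h => ⟨(hz n).1, h⟩⟩
      by_cases h : z n ∈ Set.Iic a
      · rw [Set.indicator_of_mem h, Set.indicator_of_mem (h0.2 h)]
      · rw [Set.indicator_of_notMem h, Set.indicator_of_notMem (mt h0.1 h)]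
    simp only [h1, h2]
    linarith
  · rintro _ ⟨a, rfl⟩
    choose E hEm hE hEa using fun i => hbr i (a i)
    refine ⟨⋃ i, (fun x : Fin d → ℝ => x i) ⁻¹' E i, ?_, fun s hs t ht hst => ?_⟩
    · refine (measureReal_iUnion_fintype_le _).trans ?_
      have h1 : ∀ i, μ.real ((fun x : Fin d → ℝ => x i) ⁻¹' E i) ≤ 1 / K := fun i => by
        have := hE i
        rwa [map_measureReal_apply (measurable_pi_apply i) (hEm i)] at this
      refine (Finset.sum_le_card_nsmul _ _ _ fun i _ => h1 i).trans ?_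
      rw [div_lt_iff₀ (half_pos hε)] at hK
      rw [Finset.card_univ, Fintype.card_fin, nsmul_eq_mul, mul_one_div, div_le_iff₀ hK0]
      linarith
    · simp only [Set.mem_Iic, Pi.le_def, not_forall, not_le] at ht
      obtain ⟨i, hi⟩ := ht
      have h := hEa i (s i) (t i) (hs i) hi (congrFun hst i)
      exact ⟨Set.mem_iUnion.2 ⟨i, h.1⟩, Set.mem_iUnion.2 ⟨i, h.2⟩⟩

end Empirical

/-- The accumulated halving errors are dominated by the first one. -/
theorem exists_sum_log_rpow_le {p b : ℝ} (hp : 0 ≤ p) (hb : 0 ≤ b) :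
    ∃ c : ℝ, ∀ N : ℕ, 2 ≤ N → ∀ k : ℕ,
      ∑ j ∈ Finset.range k, (1 + b * Real.log ((2 ^ (j + 1) * N : ℕ) : ℝ) ^ p) / (2 ^ j * N) ≤
        c * Real.log N ^ p / N := by
  have hl2 : 0 < Real.log 2 := Real.log_pos one_lt_two
  set q := ⌈p⌉₊
  have hsummable : Summable fun j : ℕ => ((j : ℝ) + 2) ^ q / 2 ^ j := by
    have h := summable_pow_mul_geometric_of_norm_lt_one (R := ℝ) q (r := 1 / 2)
      (by norm_num [abs_of_pos])
    have h' := ((summable_nat_add_iff 2).2 h).mul_left 4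
    refine h'.congr fun j => ?_
    push_cast
    rw [pow_add, one_div, inv_pow]
    ring
  refine ⟨(1 / Real.log 2 ^ p + b) * ∑' j : ℕ, ((j : ℝ) + 2) ^ q / 2 ^ j, fun N hN k => ?_⟩
  have hN' : (2 : ℝ) ≤ N := by exact_mod_cast hN
  have hL : Real.log 2 ≤ Real.log N := Real.log_le_log two_pos hN'
  have hL0 : 0 < Real.log N := hl2.trans_le hL
  have hterm : ∀ j : ℕ, (1 + b * Real.log ((2 ^ (j + 1) * N : ℕ) : ℝ) ^ p) / (2 ^ j * N) ≤
      (1 / Real.log 2 ^ p + b) * Real.log N ^ p / N * (((j : ℝ) + 2) ^ q / 2 ^ j) := by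
    intro j
    have hlog : Real.log ((2 ^ (j + 1) * N : ℕ) : ℝ) ≤ (j + 2) * Real.log N := by
      push_cast
      rw [Real.log_mul (by positivity) (by positivity), Real.log_pow]
      push_cast
      nlinarith
    have hlog0 : 0 ≤ Real.log ((2 ^ (j + 1) * N : ℕ) : ℝ) := Real.log_natCast_nonneg _
    have h1 : Real.log ((2 ^ (j + 1) * N : ℕ) : ℝ) ^ p ≤ ((j : ℝ) + 2) ^ q * Real.log N ^ p := by
      refine (Real.rpow_le_rpow hlog0 hlog hp).trans ?_
      rw [Real.mul_rpow (by positivity) hL0.le, ← Real.rpow_natCast]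
      gcongr
      · linarith [(Nat.cast_nonneg j : (0 : ℝ) ≤ j)]
      · exact Nat.le_ceil p
    have h2 : 1 ≤ ((j : ℝ) + 2) ^ q * (1 / Real.log 2 ^ p * Real.log N ^ p) := by
      refine one_le_mul_of_one_le_of_one_le
        (one_le_pow₀ (by linarith [(Nat.cast_nonneg j : (0 : ℝ) ≤ j)])) ?_
      rw [one_div_mul_eq_div, one_le_div (Real.rpow_pos_of_pos hl2 p)]
      exact Real.rpow_le_rpow hl2.le hL hp
    have h3 := mul_le_mul_of_nonneg_left h1 hb
    have h4 : (1 / Real.log 2 ^ p + b) * Real.log N ^ p / N * (((j : ℝ) + 2) ^ q / 2 ^ j) =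
        ((1 / Real.log 2 ^ p + b) * Real.log N ^ p * ((j : ℝ) + 2) ^ q) / (2 ^ j * N) := by
      field_simp
    rw [h4]
    gcongr
    linarith
  refine (Finset.sum_le_sum fun j _ => hterm j).trans ?_
  rw [← Finset.mul_sum]
  have h5 := hsummable.sum_le_tsum (Finset.range k) fun j _ => by positivity
  refine (mul_le_mul_of_nonneg_left h5 (by positivity)).trans (le_of_eq ?_)
  ring

/-- Deduction of a weaker form of the main theorem from Larsen's bound for Tusnády's
problem: if every set of `N ≥ 2` points in `[0,1]^d` admits a coloring with anchored-box
discrepancy at most `c'_d (log N)^(d + 1/2)`, then there is a constant `c_d` such that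
for every `N ≥ 2` and every Borel probability measure `μ` on `[0,1]^d` there are points
`x_1, …, x_N ∈ [0,1]^d` with `D_N*(x_1, …, x_N; μ) ≤ c_d (log N)^(d + 1/2) / N`. -/
theorem larsen_implies_discrepancy_bound (d : ℕ) (hd : 1 ≤ d) (c' : ℝ)
    (hlarsen : ∀ N : ℕ, 2 ≤ N →
      ∀ P : Finset (Fin d → ℝ), P.card = N →
        ↑P ⊆ Set.Icc (0 : Fin d → ℝ) 1 →
        ∃ y : (Fin d → ℝ) → ℝ,
          (∀ p ∈ P, y p = 1 ∨ y p = -1) ∧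
          ∀ a : Fin d → ℝ, a ∈ Set.Icc (0 : Fin d → ℝ) 1 →
            |∑ p ∈ P, (Set.Icc (0 : Fin d → ℝ) a).indicator y p|
              ≤ c' * Real.log N ^ ((d : ℝ) + 1 / 2)) :
    ∃ c : ℝ, ∀ N : ℕ, 2 ≤ N →
      ∀ μ : Measure (Fin d → ℝ), IsProbabilityMeasure μ →
        μ (Set.Icc 0 1) = 1 →
        ∃ x : Fin N → (Fin d → ℝ),
          (∀ n, x n ∈ Set.Icc (0 : Fin d → ℝ) 1) ∧
          ∀ a : Fin d → ℝ, a ∈ Set.Icc (0 : Fin d → ℝ) 1 →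
            |(1 / N : ℝ) * ∑ n, (Set.Icc (0 : Fin d → ℝ) a).indicator
                  (fun _ => (1 : ℝ)) (x n)
                - (μ (Set.Icc 0 a)).toReal|
              ≤ c * Real.log N ^ ((d : ℝ) + 1 / 2) / N := by
  set p : ℝ := (d : ℝ) + 1 / 2
  have hp0 : 0 < p := by positivity
  set B : ℕ → ℝ := fun n => 1 + |c'| * Real.log n ^ p with hBdef
  have hB : Monotone B := by
    intro m n hmn
    have hlog : Real.log m ≤ Real.log n := by
      rcases Nat.eq_zero_or_pos m with rfl | hm
      · simpa using Real.log_natCast_nonneg n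
      · exact Real.log_le_log (by exact_mod_cast hm) (by exact_mod_cast hmn)
    have h := Real.rpow_le_rpow (Real.log_natCast_nonneg m) hlog hp0.le
    simp only [hBdef]
    gcongr
  set 𝒜 : Set (Set (Fin d → ℝ)) := Set.Icc 0 '' Set.Icc 0 1
  have hcol : ∀ P : Finset (Fin d → ℝ), ↑P ⊆ Set.Icc (0 : Fin d → ℝ) 1 →
      ∃ y : (Fin d → ℝ) → ℝ, (∀ q ∈ P, y q = 1 ∨ y q = -1) ∧
        ∀ A ∈ 𝒜, |∑ q ∈ P, A.indicator y q| ≤ B P.card := by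
    intro P hP
    have hBP : ∀ r : ℝ, 0 ≤ r ^ p → c' * r ^ p ≤ 1 + |c'| * r ^ p := fun r hr =>
      (mul_le_mul_of_nonneg_right (le_abs_self c') hr).trans (by linarith)
    rcases le_or_gt 2 P.card with h2 | h2
    · obtain ⟨y, hy, hyA⟩ := hlarsen P.card h2 P rfl hP
      refine ⟨y, hy, ?_⟩
      rintro _ ⟨a, ha, rfl⟩
      exact (hyA a ha).trans (hBP _ (Real.rpow_nonneg (Real.log_natCast_nonneg _) _))
    · refine ⟨fun _ => 1, fun _ _ => Or.inl rfl, fun A _ => ?_⟩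
      have h := abs_sum_indicator_sub_le (A := A) (fun q : Fin d → ℝ => q) (Finset.empty_subset P)
      simp only [Finset.sum_empty, sub_zero, Finset.card_empty, Nat.cast_zero] at h
      have h1 : (P.card : ℝ) ≤ 1 := by exact_mod_cast Nat.le_of_lt_succ h2
      have h3 : 0 ≤ |c'| * Real.log P.card ^ p :=
        mul_nonneg (abs_nonneg _) (Real.rpow_nonneg (Real.log_natCast_nonneg _) _)
      exact h.trans (h1.trans (le_add_of_nonneg_right h3))
  obtain ⟨c, hc⟩ := exists_sum_log_rpow_le hp0.le (abs_nonneg c')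
  refine ⟨c + 1, fun N hN μ hμ hμ1 => ?_⟩
  have hN0 : (0 : ℝ) < N := by positivity
  have hlogN : 0 < Real.log N := Real.log_pos (by exact_mod_cast hN)
  have hε : 0 < Real.log N ^ p / N := div_pos (Real.rpow_pos_of_pos hlogN p) hN0
  obtain ⟨M₀, hM₀⟩ := exists_points_approx_boxes μ hμ1 hε
  have hM : M₀ ≤ 2 ^ M₀ * N := Nat.lt_two_pow_self.le.trans (Nat.le_mul_of_pos_right _ (by omega))
  obtain ⟨z, hz, hzA⟩ := hM₀ _ hM
  have hQ : Set.Icc (0 : Fin d → ℝ) 1 ∈ 𝒜 := ⟨1, ⟨zero_le_one, le_rfl⟩, rfl⟩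
  obtain ⟨T, -, hT, hTA⟩ := exists_iterated_halving hQ z hz (exists_coloring_family hB hcol z hz)
    (by omega : 0 < N) M₀ Finset.univ (by simp)
  let e : Fin N ≃ T := (T.equivFinOfCardEq hT).symm
  refine ⟨fun n => z (e n), fun n => hz _, fun a ha => ?_⟩
  have hsum : ∑ n, (Set.Icc (0 : Fin d → ℝ) a).indicator (fun _ => (1 : ℝ)) (z (e n)) =
      ∑ i ∈ T, (Set.Icc (0 : Fin d → ℝ) a).indicator (fun _ => (1 : ℝ)) (z i) := by
    rw [Equiv.sum_comp e fun i : T => (Set.Icc 0 a).indicator (fun _ => (1 : ℝ)) (z i)]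
    exact Finset.sum_coe_sort T fun i => (Set.Icc 0 a).indicator (fun _ => (1 : ℝ)) (z i)
  rw [hsum, one_div_mul_eq_div, add_mul, add_div, one_mul]
  have h1 := (hTA _ ⟨a, ha, rfl⟩).trans (hc N hN M₀)
  have h2 := hzA a
  push_cast at h2
  exact (abs_sub_le _ _ _).trans (add_le_add h1 h2)
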